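/- Let (B, ∘) be a finite-dimensional real left-symmetric algebra with a Hessian metric h, and let D ∈ End(B) be a compatible derivation. On A = B × ℝ define the multiplication (x,a)∗(y,b) = (x∘y + a·Dy, h(x,y) + a·b) and the bilinear form ĥ((x,a),(y,b)) = h(x,y) + a·b. Then: (i) (A, ∗) is a left-symmetric algebra; (ii) the linear functional λ(x,a) = a satisfies λ(u∗v) = ĥ(u,v) for all u, v ∈ A, so λ is a Koszul form with associated metric ĥ, and its associated idempotent is (0,1), which satisfies ker R((0,1)) = B × {0} and R((0,1))² = R((0,1)); (iii) if D is invertible, then B × {0} = span{ u∗v − v∗u : u, v ∈ A } and (A, ∗) is simple, i.e. span{u∗v : u,v ∈ A} ≠ 0 and the only two-sided ideals of (A, ∗) are 0 and A. -/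

import Mathlib

/-- The graph extension multiplication on B × ℝ:
(x,a)∗(y,b) = (x∘y + a·Dy, h(x,y) + a·b). -/
def gmul {B : Type*} [AddCommGroup B] [Module ℝ B]
    (cmul : B →ₗ[ℝ] B →ₗ[ℝ] B) (h : B →ₗ[ℝ] B →ₗ[ℝ] ℝ) (D : B →ₗ[ℝ] B)
    (p q : B × ℝ) : B × ℝ :=
  (cmul p.1 q.1 + p.2 • D q.1, h p.1 q.1 + p.2 * q.2)

/-- The bilinear form ĥ((x,a),(y,b)) = h(x,y) + a·b on B × ℝ. -/
def hhat {B : Type*} [AddCommGroup B] [Module ℝ B]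
    (h : B →ₗ[ℝ] B →ₗ[ℝ] ℝ) (p q : B × ℝ) : ℝ :=
  h p.1 q.1 + p.2 * q.2

theorem stmt17 (B : Type*) [AddCommGroup B] [Module ℝ B] [FiniteDimensional ℝ B]
    (cmul : B →ₗ[ℝ] B →ₗ[ℝ] B)
    (hlsa : ∀ x y z : B,
      cmul (cmul x y) z - cmul x (cmul y z) = cmul (cmul y x) z - cmul y (cmul x z))
    (h : B →ₗ[ℝ] B →ₗ[ℝ] ℝ)
    (hsymm : ∀ x y, h x y = h y x)
    (hnd : ∀ x, (∀ y, h x y = 0) → x = 0)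
    -- the cubic form (x,y,z) ↦ h(x∘y,z) + h(y,x∘z) is totally symmetric
    (hhess : ∀ x y z : B,
      (h (cmul x y) z + h y (cmul x z) = h (cmul y x) z + h x (cmul y z)) ∧
      (h (cmul x y) z + h y (cmul x z) = h (cmul x z) y + h z (cmul x y)))
    (D : B →ₗ[ℝ] B)
    (hDder : ∀ x y : B, D (cmul x y) = cmul (D x) y + cmul x (D y))
    (hDcomp : ∀ x y : B, h (D x) y + h x (D y) = h x y) :
    -- (i) (B × ℝ, ∗) is a left-symmetric algebra
    (∀ p q s : B × ℝ,
      gmul cmul h D (gmul cmul h D p q) s - gmul cmul h D p (gmul cmul h D q s) =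
        gmul cmul h D (gmul cmul h D q p) s - gmul cmul h D q (gmul cmul h D p s)) ∧
    -- (ii) λ(p) = p.2 is a Koszul form with associated metric ĥ and
    --      associated idempotent (0,1), ker R((0,1)) = B × {0}, R((0,1))² = R((0,1))
    ((∀ p q : B × ℝ, (gmul cmul h D p q).2 = hhat h p q) ∧
      (∀ p q : B × ℝ, hhat h p q = hhat h q p) ∧
      (∀ p : B × ℝ, (∀ q : B × ℝ, hhat h p q = 0) → p = 0) ∧
      gmul cmul h D ((0 : B), (1 : ℝ)) ((0 : B), (1 : ℝ)) = ((0 : B), (1 : ℝ)) ∧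
      (∀ q : B × ℝ, (gmul cmul h D ((0 : B), (1 : ℝ)) q).2 = q.2) ∧
      (∀ p : B × ℝ, gmul cmul h D p ((0 : B), (1 : ℝ)) = 0 ↔ p.2 = 0) ∧
      (∀ p : B × ℝ,
        gmul cmul h D (gmul cmul h D p ((0 : B), (1 : ℝ))) ((0 : B), (1 : ℝ)) =
          gmul cmul h D p ((0 : B), (1 : ℝ)))) ∧
    -- (iii) if D is invertible then B × {0} = [A,A] and (A, ∗) is simple
    (Function.Bijective D →
      (Submodule.span ℝ {z : B × ℝ | ∃ p q : B × ℝ,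
          z = gmul cmul h D p q - gmul cmul h D q p} =
        (⊤ : Submodule ℝ B).prod (⊥ : Submodule ℝ ℝ)) ∧
      Submodule.span ℝ {z : B × ℝ | ∃ p q : B × ℝ, z = gmul cmul h D p q} ≠ ⊥ ∧
      (∀ J : Submodule ℝ (B × ℝ),
        (∀ p : B × ℝ, ∀ j ∈ J, gmul cmul h D p j ∈ J ∧ gmul cmul h D j p ∈ J) →
        J = ⊥ ∨ J = ⊤)) := by
  refine ⟨?_, ⟨?_, ?_, ?_, ?_, ?_, ?_, ?_⟩, ?_⟩
  · rintro ⟨x, a⟩ ⟨y, b⟩ ⟨z, c⟩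
    refine Prod.ext ?_ ?_
    · have e := hlsa x y z
      simp only [gmul, Prod.fst_sub, map_add, map_smul, LinearMap.add_apply,
        LinearMap.smul_apply, hDder, hsymm y x]
      linear_combination (norm := module) e
    · simp only [gmul, Prod.snd_sub, map_add, map_smul, LinearMap.add_apply,
        LinearMap.smul_apply, smul_eq_mul]
      linear_combination (hhess x y z).1 + a * hDcomp y z - b * hDcomp x z + c * hsymm x y
  · intro p q
    rfl
  · intro p q
    simp only [hhat, hsymm p.1 q.1, mul_comm p.2]
  · rintro ⟨x, a⟩ hp
    refine Prod.ext (hnd x fun y => ?_) ?_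
    · simpa [hhat] using hp (y, 0)
    · simpa [hhat] using hp (0, 1)
  · simp [gmul]
  · simp [gmul]
  · simp [gmul]
  · simp [gmul]
  · intro hD
    refine ⟨le_antisymm ?_ ?_, ?_, ?_⟩
    · rw [Submodule.span_le]
      rintro _ ⟨p, q, rfl⟩
      simp [gmul, hsymm p.1 q.1, mul_comm p.2]
    · rintro ⟨x, a⟩ hx
      obtain rfl : a = 0 := by simpa using hx
      obtain ⟨y, rfl⟩ := hD.2 x
      exact Submodule.subset_span ⟨(0, 1), (y, 0), by simp [gmul]⟩
    · intro hbot
      have hmem : ((0, 1) : B × ℝ) ∈ Submodule.span ℝ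
          {z : B × ℝ | ∃ p q : B × ℝ, z = gmul cmul h D p q} :=
        Submodule.subset_span ⟨(0, 1), (0, 1), by simp [gmul]⟩
      rw [hbot] at hmem
      simp at hmem
    · intro J hJ
      by_cases hJ0 : ∀ j ∈ J, j.2 = 0
      · refine Or.inl ((Submodule.eq_bot_iff J).2 fun j hj => ?_)
        refine Prod.ext (hnd j.1 fun y => ?_) (hJ0 j hj)
        simpa [gmul] using hJ0 _ (hJ (y, 0) j hj).2
      · push Not at hJ0
        obtain ⟨j, hj, hj2⟩ := hJ0
        have hw : ((0, 1) : B × ℝ) ∈ J := by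
          simpa [gmul, hj2] using J.smul_mem j.2⁻¹ (hJ (0, 1) j hj).2
        refine Or.inr ((Submodule.eq_top_iff').2 ?_)
        rintro ⟨x, a⟩
        obtain ⟨y, rfl⟩ := hD.2 x
        have hy : (D y, (0 : ℝ)) ∈ J := by
          simpa [gmul] using (hJ (y, 0) _ hw).2
        simpa using J.add_mem hy (J.smul_mem a hw)
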